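/- Let V ⊆ ℂ be open and let u : V → ℂ be a differentiable function with u(q)² = (q²+1)(q²−4q+9) for all q ∈ V. Define on V: t₄₄(q) = 1/2 + (q¹⁰−10q⁹+45q⁸−120q⁷+190q⁶+4q⁵−410q⁴+680q³+25q²−90q−27) / (2 (q²−4q−1)(q²+1) u(q)³), and y₄₅(q) = 1/2 + (3q¹⁰−24q⁹+93q⁸−216q⁷+446q⁶+320q⁵−1342q⁴+2824q³+527q²−312q−207) / (6 (q²−4q−1)(q⁴−2q³+8q²+10q+23)(q²+1) u(q)), assuming all denominators are nonzero on V. Let q₀ ∈ V with t₄₄'(q₀) ≠ 0, t₄₄(q₀) ∉ {0,1}, and y₄₅(q₀) ∉ {0, 1, t₄₄(q₀)}. Suppose Y is twice differentiable on a neighbourhood of t₄₄(q₀) with Y(t₄₄(q)) = y₄₅(q) for q near q₀, avoiding 0, 1 and its argument. Then Y is a solution of P_VI(1/2, 1/2, 2/5, 2/5; t) on a neighbourhood of t₄₄(q₀) (an icosahedral algebraic Painlevé VI solution of Boalch type 45). -/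

import Mathlib

/-- The right-hand side of the sixth Painlevé equation with local monodromy
differences `θ0, θ1, θt, θinf` (via `α = (θ∞−1)²/2`, `β = −θ₀²/2`,
`γ = θ₁²/2`, `δ = (1−θ_t²)/2`), evaluated on the function `y` at the point `t`. -/
noncomputable def pviRHS (θ0 θ1 θt θinf : ℂ) (y : ℂ → ℂ) (t : ℂ) : ℂ :=
  (1/2) * (1/(y t) + 1/(y t - 1) + 1/(y t - t)) * (deriv y t)^2
    - (1/t + 1/(t-1) + 1/(y t - t)) * deriv y t
    + (y t * (y t - 1) * (y t - t) / (t^2 * (t-1)^2)) *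
      ((θinf - 1)^2/2 + (-(θ0^2/2)) * t/(y t)^2 + (θ1^2/2) * (t-1)/(y t - 1)^2
        + ((1 - θt^2)/2) * (t*(t-1))/(y t - t)^2)

/-- `y` satisfies the sixth Painlevé equation `P_VI(θ0,θ1,θt,θinf)` at the point `t`. -/
def PVIAt (θ0 θ1 θt θinf : ℂ) (y : ℂ → ℂ) (t : ℂ) : Prop :=
  deriv (deriv y) t = pviRHS θ0 θ1 θt θinf y t

/-- `y` is a solution of the sixth Painlevé equation `P_VI(θ0,θ1,θt,θinf;t)` on the
open set `U ⊆ ℂ`: `U` is open, `t ∉ {0,1}` and `y t ∉ {0,1,t}` on `U`, `y` is twice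
differentiable on `U`, and the Painlevé VI equation holds at every point of `U`. -/
def IsPVISolutionOn (θ0 θ1 θt θinf : ℂ) (y : ℂ → ℂ) (U : Set ℂ) : Prop :=
  IsOpen U ∧
  (∀ t ∈ U, t ≠ 0 ∧ t ≠ 1 ∧ y t ≠ 0 ∧ y t ≠ 1 ∧ y t ≠ t) ∧
  (∀ t ∈ U, DifferentiableAt ℂ y t ∧ DifferentiableAt ℂ (deriv y) t) ∧
  (∀ t ∈ U, PVIAt θ0 θ1 θt θinf y t)

/-- The denominator `Z(t)` appearing in the Okamoto transformation. -/
noncomputable def okZ (ν0 ν1 νt : ℂ) (y : ℂ → ℂ) (t : ℂ) : ℂ :=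
  ((t-1) * deriv y t - ν0) / (y t)
    - (t * deriv y t + ν1) / (y t - 1)
    + (deriv y t - 1 - νt) / (y t - t)

/-- The Okamoto operator `K_{[ν0,ν1,νt,νinf;t]} y = y + (ν0+ν1+νt+νinf)/Z`. -/
noncomputable def okK (ν0 ν1 νt νinf : ℂ) (y : ℂ → ℂ) (t : ℂ) : ℂ :=
  y t + (ν0 + ν1 + νt + νinf) / okZ ν0 ν1 νt y t

namespace I45
/-- Auxiliary polynomial. -/
def pA (q : ℂ) : ℂ := q^2-4*q-1
/-- Its derivative. -/
def dA (q : ℂ) : ℂ := 2*q-4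
/-- Auxiliary polynomial. -/
def pB (q : ℂ) : ℂ := q^2+1
/-- Its derivative. -/
def dB (q : ℂ) : ℂ := 2*q
/-- Auxiliary polynomial. -/
def pC (q : ℂ) : ℂ := q^2-4*q+9
/-- Its derivative. -/
def dC (q : ℂ) : ℂ := 2*q-4
/-- Auxiliary polynomial. -/
def pD (q : ℂ) : ℂ := q^4-2*q^3+8*q^2+10*q+23
/-- Its derivative. -/
def dD (q : ℂ) : ℂ := 4*q^3-6*q^2+16*q+10
/-- Auxiliary polynomial. -/
def pN (q : ℂ) : ℂ := q^2-2*q+5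
/-- Its derivative. -/
def dN (q : ℂ) : ℂ := 2*q-2
/-- Auxiliary polynomial. -/
def pPn (q : ℂ) : ℂ := q^10-10*q^9+45*q^8-120*q^7+190*q^6+4*q^5-410*q^4+680*q^3+25*q^2-90*q-27
/-- Its derivative. -/
def dPn (q : ℂ) : ℂ := 10*q^9-90*q^8+360*q^7-840*q^6+1140*q^5+20*q^4-1640*q^3+2040*q^2+50*q-90
/-- Auxiliary polynomial. -/
def pR (q : ℂ) : ℂ := 3*q^10-24*q^9+93*q^8-216*q^7+446*q^6+320*q^5-1342*q^4+2824*q^3+527*q^2-312*q-207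
/-- Its derivative. -/
def dR (q : ℂ) : ℂ := 30*q^9-216*q^8+744*q^7-1512*q^6+2676*q^5+1600*q^4-5368*q^3+8472*q^2+1054*q-312
/-- Auxiliary polynomial. -/
def pS (q : ℂ) : ℂ := 21*q^13-114*q^12-6*q^11+2580*q^10-13805*q^9+44026*q^8-89204*q^7+113704*q^6-56965*q^5-86190*q^4+147514*q^3-87036*q^2-5859*q-14490
/-- Auxiliary polynomial. -/
def pQ (q : ℂ) : ℂ := 7*q^7-34*q^6+55*q^5+130*q^4-795*q^3+1706*q^2-1827*q+630
/-- Auxiliary polynomial. -/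
def pK (q : ℂ) : ℂ := 28*q^18-225*q^17+233*q^16+7460*q^15-62260*q^14+279112*q^13-847520*q^12+1884132*q^11-3166620*q^10+4146590*q^9-4313734*q^8+3707980*q^7-1762524*q^6-650640*q^5+1780360*q^4-1797204*q^3+1675920*q^2+27531*q+65205
/-- Its derivative. -/
def dK (q : ℂ) : ℂ := 504*q^17-3825*q^16+3728*q^15+111900*q^14-871640*q^13+3628456*q^12-10170240*q^11+20725452*q^10-31666200*q^9+37319310*q^8-34509872*q^7+25955860*q^6-10575144*q^5-3253200*q^4+7121440*q^3-5391612*q^2+3351840*q+27531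
/-- Auxiliary polynomial. -/
def pK2 (q : ℂ) : ℂ := 56*q^26-1064*q^25+11769*q^24-88848*q^23+498821*q^22-2242608*q^21+8443467*q^20-27061312*q^19+71315019*q^18-142578728*q^17+167063254*q^16+89769984*q^15-1009529534*q^14+2768919488*q^13-4952745786*q^12+6372403488*q^11-6268439042*q^10+4542295272*q^9-2654995419*q^8+381230608*q^7+127778601*q^6+575751536*q^5-1604715841*q^4+589035552*q^3-49905009*q^2+59409000*q+29994300
/-- Auxiliary polynomial. -/
def pH (q : ℂ) : ℂ := 56*q^15-198*q^14-1111*q^13+12913*q^12-55594*q^11+141796*q^10-231153*q^9+239579*q^8-111732*q^7+83066*q^6+7399*q^5-301977*q^4+238886*q^3+193512*q^2+20769*q+7245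

open Polynomial in
lemma hdPn (q : ℂ) : HasDerivAt pPn (dPn q) q := by
  have h := (C (1:ℂ) * X^10 - C 10*X^9 + C 45*X^8 - C 120*X^7 + C 190*X^6 + C 4*X^5 - C 410*X^4
    + C 680*X^3 + C 25*X^2 - C 90*X - C 27 : ℂ[X]).hasDerivAt q
  refine (h.congr_deriv ?_).congr_of_eventuallyEq (Filter.Eventually.of_forall fun x => ?_)
  · simp [dPn]; ring
  · simp [pPn]

open Polynomial in
lemma hdR (q : ℂ) : HasDerivAt pR (dR q) q := by
  have h := (C (3:ℂ) * X^10 - C 24*X^9 + C 93*X^8 - C 216*X^7 + C 446*X^6 + C 320*X^5 - C 1342*X^4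
    + C 2824*X^3 + C 527*X^2 - C 312*X - C 207 : ℂ[X]).hasDerivAt q
  refine (h.congr_deriv ?_).congr_of_eventuallyEq (Filter.Eventually.of_forall fun x => ?_)
  · simp [dR]; ring
  · simp [pR]

open Polynomial in
lemma hdK (q : ℂ) : HasDerivAt pK (dK q) q := by
  have h := (C 28*X^18-C 225*X^17+C 233*X^16+C 7460*X^15-C 62260*X^14+C 279112*X^13-C 847520*X^12+C 1884132*X^11-C 3166620*X^10+C 4146590*X^9-C 4313734*X^8+C 3707980*X^7-C 1762524*X^6-C 650640*X^5+C 1780360*X^4-C 1797204*X^3+C 1675920*X^2+C 27531*X+C 65205 : ℂ[X]).hasDerivAt q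
  refine (h.congr_deriv ?_).congr_of_eventuallyEq (Filter.Eventually.of_forall fun x => ?_)
  · simp [dK]; ring
  · simp [pK]

open Polynomial in
lemma hdA (q : ℂ) : HasDerivAt pA (dA q) q := by
  have h := (X^2 - C 4*X - C 1 : ℂ[X]).hasDerivAt q
  refine (h.congr_deriv ?_).congr_of_eventuallyEq (Filter.Eventually.of_forall fun x => ?_)
  · simp [dA]; norm_num
  · simp [pA]

open Polynomial in
lemma hdB (q : ℂ) : HasDerivAt pB (dB q) q := by
  have h := (X^2 + C 1 : ℂ[X]).hasDerivAt q
  refine (h.congr_deriv ?_).congr_of_eventuallyEq (Filter.Eventually.of_forall fun x => ?_)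
  · simp [dB]; norm_num
  · simp [pB]

open Polynomial in
lemma hdC (q : ℂ) : HasDerivAt pC (dC q) q := by
  have h := (X^2 - C 4*X + C 9 : ℂ[X]).hasDerivAt q
  refine (h.congr_deriv ?_).congr_of_eventuallyEq (Filter.Eventually.of_forall fun x => ?_)
  · simp [dC]; norm_num
  · simp [pC]

open Polynomial in
lemma hdN (q : ℂ) : HasDerivAt pN (dN q) q := by
  have h := (X^2 - C 2*X + C 5 : ℂ[X]).hasDerivAt q
  refine (h.congr_deriv ?_).congr_of_eventuallyEq (Filter.Eventually.of_forall fun x => ?_)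
  · simp [dN]; norm_num
  · simp [pN]

open Polynomial in
lemma hdD (q : ℂ) : HasDerivAt pD (dD q) q := by
  have h := (X^4 - C 2*X^3 + C 8*X^2 + C 10*X + C 23 : ℂ[X]).hasDerivAt q
  refine (h.congr_deriv ?_).congr_of_eventuallyEq (Filter.Eventually.of_forall fun x => ?_)
  · simp [dD]; ring
  · simp [pD]

/-- Derivative of a function `1/2 + P/(E u)` with `u² = v`. -/
lemma core {P E u : ℂ → ℂ} {P' E' v v' q : ℂ} {f : ℂ → ℂ}
    (hP : HasDerivAt P P' q) (hE : HasDerivAt E E' q) (hu : HasDerivAt u (v' / (2 * u q)) q)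
    (hv : (u q)^2 = v) (hE0 : E q ≠ 0) (hu0 : u q ≠ 0)
    (hf : f =ᶠ[nhds q] fun x => 1/2 + P x / (E x * u x)) :
    HasDerivAt f ((2*(P' * E q - P q * E') * v - P q * E q * v') / (2 * (E q)^2 * v * u q)) q := by
  have h := ((hP.div (hE.mul hu) (mul_ne_zero hE0 hu0)).const_add (1/2)).congr_of_eventuallyEq hf
  refine h.congr_deriv ?_
  subst hv
  simp only [Pi.mul_apply]
  field_simp
  ring

/-- The sixth Painlevé equation from its polynomial form. -/
lemma pvi_of_poly (Y : ℂ → ℂ) (t y d dd : ℂ) (hy : Y t = y) (hd : deriv Y t = d)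
    (hdd : deriv (deriv Y) t = dd)
    (h0 : t ≠ 0) (h1 : t - 1 ≠ 0) (hy0 : y ≠ 0) (hy1 : y - 1 ≠ 0) (hyt : y - t ≠ 0)
    (T Z W : ℂ) (hT : T = t*(t-1)) (hZ : Z = y*(y-1)) (hW : W = (y-t)^2)
    (h : 2*T^2*Z*((y-t)*dd) = T^2*(2*Z - T + W)*d^2 - 2*T*(Z-W)*Z*d + 9/25*Z^2*W
      - (W-T)*W/4 + 21/25*T*Z^2) :
    PVIAt (1/2) (1/2) (2/5) (2/5) Y t := by
  unfold PVIAt pviRHS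
  rw [hy, hd, hdd]
  subst hT hZ hW
  rw [← sub_eq_zero] at h ⊢
  have hD : 2*(t*(t-1))^2*(y*(y-1))*(y-t) ≠ 0 := by simp [h0, h1, hy0, hy1, hyt]
  rw [← mul_right_inj' hD, mul_zero, ← h]
  field_simp
  ring

/-- Reduction of the polynomial form to a polynomial identity on the `q`-line. -/
lemma abstract_id (q L G N A B C D S Q K K2 T Z W M X : ℂ)
    (hq : q ≠ 0) (hL : L ≠ 0) (_hG : G ≠ 0) (_hN : N ≠ 0) (hA : A ≠ 0) (hB : B ≠ 0)
    (hC : C ≠ 0) (hD : D ≠ 0)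
    (hT : T = 16*q^3*L^3*G^5*N^2/(A^2*B^5*C^3))
    (hZ : Z = 4*q*L^2*S/(9*A^2*D^2*B^3*C))
    (hW : W = 16*q^2*L^4*Q^2/(9*A^2*D^2*B^5*C^3))
    (hM : M = K/(60*D^2*q^2*L*G^4*N))
    (hX : X = -(Q*K2*A*B*C)/(7200*D^4*q^4*L^2*G^9*N^3))
    (H : -((64:ℂ)/2025)*G*N*S*Q*K2*A*B^3*C^3 =
      ((16:ℂ)/225)*G^2*N^2*K^2*(8/9*S*B^2*C^2 - 16*q^2*L*G^5*N^2*D^2 + 16/9*q*L^2*Q^2) - ((128:ℂ)/1215)*G*N*K*S*B^2*C^2*(S*B^2*C^2 - 4*q*L^2*Q^2) + ((256:ℂ)/2025)*q*L^2*S^2*Q^2*B^4*C^4 - ((64:ℂ)/9)*q*L*Q^2*D^2*A^2*B^5*C^3*(1/9*L*Q^2 - q*G^5*N^2*D^2) + ((1792:ℂ)/675)*q^2*L*G^5*N^2*S^2*D^2*B^4*C^4) :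
    2*T^2*Z*X = T^2*(2*Z - T + W)*M^2 - 2*T*(Z-W)*Z*M + 9/25*Z^2*W
      - (W-T)*W/4 + 21/25*T*Z^2 := by
  have key : 2*T^2*Z*X - (T^2*(2*Z - T + W)*M^2 - 2*T*(Z-W)*Z*M + 9/25*Z^2*W
      - (W-T)*W/4 + 21/25*T*Z^2) = (q^3*L^6*(-((64:ℂ)/2025)*G*N*S*Q*K2*A*B^3*C^3) - q^3*L^6*(((16:ℂ)/225)*G^2*N^2*K^2*(8/9*S*B^2*C^2 - 16*q^2*L*G^5*N^2*D^2 + 16/9*q*L^2*Q^2) - ((128:ℂ)/1215)*G*N*K*S*B^2*C^2*(S*B^2*C^2 - 4*q*L^2*Q^2) + ((256:ℂ)/2025)*q*L^2*S^2*Q^2*B^4*C^4 - ((64:ℂ)/9)*q*L*Q^2*D^2*A^2*B^5*C^3*(1/9*L*Q^2 - q*G^5*N^2*D^2) + ((1792:ℂ)/675)*q^2*L*G^5*N^2*S^2*D^2*B^4*C^4))/(D^6*A^6*B^15*C^9) := by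
    subst hT hZ hW hM hX
    field_simp
    ring
  rw [H, sub_self, zero_div, sub_eq_zero] at key
  exact key

lemma big (q : ℂ) : -((64:ℂ)/2025)*(q-2)*(pN q)*(pS q)*(pQ q)*(pK2 q)*(pA q)*(pB q)^3*(pC q)^3 =
      ((16:ℂ)/225)*(q-2)^2*(pN q)^2*(pK q)^2*(8/9*(pS q)*(pB q)^2*(pC q)^2 - 16*q^2*(2*q+1)*(q-2)^5*(pN q)^2*(pD q)^2 + 16/9*q*(2*q+1)^2*(pQ q)^2) - ((128:ℂ)/1215)*(q-2)*(pN q)*(pK q)*(pS q)*(pB q)^2*(pC q)^2*((pS q)*(pB q)^2*(pC q)^2 - 4*q*(2*q+1)^2*(pQ q)^2) + ((256:ℂ)/2025)*q*(2*q+1)^2*(pS q)^2*(pQ q)^2*(pB q)^4*(pC q)^4 - ((64:ℂ)/9)*q*(2*q+1)*(pQ q)^2*(pD q)^2*(pA q)^2*(pB q)^5*(pC q)^3*(1/9*(2*q+1)*(pQ q)^2 - q*(q-2)^5*(pN q)^2*(pD q)^2) + ((1792:ℂ)/675)*q^2*(2*q+1)*(q-2)^5*(pN q)^2*(pS q)^2*(pD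 q)^2*(pB q)^4*(pC q)^4 := by
  unfold pS pQ pK pK2 pA pB pC pD pN
  ring

lemma idT (q : ℂ) : (pPn q)^2 - (pA q)^2*(pB q)^5*(pC q)^3
    = 64*q^3*(2*q+1)^3*(q-2)^5*(pN q)^2 := by
  unfold pPn pA pB pC pN; ring

lemma idZ (q : ℂ) : (pR q)^2 - 9*(pA q)^2*(pD q)^2*(pB q)^3*(pC q)
    = 16*q*(2*q+1)^2*pS q := by
  unfold pR pA pD pB pC pS; ring

lemma idW (q : ℂ) : pR q*pB q*pC q - 3*pD q*pPn q = 8*q*(2*q+1)^2*pQ q := by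
  unfold pR pB pC pD pPn pQ; ring

lemma idt' (q : ℂ) : (2*(dPn q * (2*pA q*pB q^2*pC q) - pPn q *
      (2*(dA q*pB q^2*pC q + 2*pA q*pB q*dB q*pC q + pA q*pB q^2*dC q))) * (pB q*pC q)
      - pPn q * (2*pA q*pB q^2*pC q) * (dB q*pC q+pB q*dC q))
    = -1280*q^2*(2*q+1)^2*(q-2)^4*pN q*(pB q)^2*(pC q) := by
  unfold pPn pA pB pC pN dPn dA dB dC; ring

lemma idy' (q : ℂ) : (2*(dR q * (6*pA q*pD q*pB q) - pR q *
      (6*(dA q*pD q*pB q + pA q*dD q*pB q + pA q*pD q*dB q))) * (pB q*pC q)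
      - pR q * (6*pA q*pD q*pB q) * (dB q*pC q+pB q*dC q))
    = -192*pH q*pB q := by
  unfold pR pA pB pC pD pH dR dA dB dC dD; ring

lemma idM (q : ℂ) : pH q*pB q*pC q = pK q*(2*q+1) := by
  unfold pH pB pC pK; ring

lemma idM' (q : ℂ) : dK q*(pD q*q*(2*q+1)*(q-2)*pN q) - pK q*(2*dD q*q*(2*q+1)*(q-2)*pN q
     + 2*pD q*(2*q+1)*(q-2)*pN q + 2*pD q*q*(q-2)*pN q + 4*pD q*q*(2*q+1)*pN q
     + pD q*q*(2*q+1)*(q-2)*dN q) = pK2 q := by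
  unfold dK pK pD dD pN dN pK2; ring


lemma deriv_u {V : Set ℂ} (hV : IsOpen V) {u : ℂ → ℂ} {q : ℂ} (hq : q ∈ V)
    (hd : DifferentiableAt ℂ u q) (hu : ∀ q ∈ V, (u q)^2 = pB q * pC q) (h0 : u q ≠ 0) :
    HasDerivAt u ((dB q * pC q + pB q * dC q) / (2 * u q)) q := by
  have h1 := hd.hasDerivAt
  have h2 : HasDerivAt (fun x => u x ^ 2) (2 * u q * deriv u q) q := by
    simpa using h1.fun_pow 2
  have h3 : HasDerivAt (fun x => u x ^ 2) (dB q * pC q + pB q * dC q) q :=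
    ((hdB q).mul (hdC q)).congr_of_eventuallyEq
      (Filter.eventually_of_mem (hV.mem_nhds hq) (fun x hx => hu x hx))
  have h4 := h2.unique h3
  refine h1.congr_deriv ?_
  rw [← h4]; field_simp

lemma deriv_M {q : ℂ} (hq : q ≠ 0) (hL : 2*q+1 ≠ 0) (hG : q-2 ≠ 0) (hN : pN q ≠ 0)
    (hD : pD q ≠ 0) :
    HasDerivAt (fun q => pK q / (60*pD q^2*q^2*(2*q+1)*(q-2)^4*pN q))
      (pK2 q / (60*pD q^3*q^3*(2*q+1)^2*(q-2)^5*pN q^2)) q := by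
  have hid := hasDerivAt_id q
  have hLd : HasDerivAt (fun q : ℂ => 2*q+1) 2 q := by
    simpa using (hid.const_mul 2).add_const 1
  have hGd : HasDerivAt (fun q : ℂ => q-2) 1 q := by
    simpa using hid.sub_const 2
  have h := (hdK q).fun_div ((((((hdD q).fun_pow 2).const_mul 60).fun_mul (hid.fun_pow 2)).fun_mul hLd).fun_mul
    (hGd.fun_pow 4) |>.fun_mul (hdN q)) (by simp [hq, hL, hG, hN, hD])
  refine h.congr_deriv ?_
  rw [← idM' q]
  simp only [id]
  generalize pK q = K at *
  generalize dK q = K' at *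
  generalize pD q = D at *
  generalize dD q = D' at *
  generalize pN q = N at *
  generalize dN q = N' at *
  push_cast
  field_simp

end I45

/-- The icosahedral algebraic Painlevé VI solution of Boalch type 45:
`y₄₅(t₄₄)` on the elliptic curve `u² = (q²+1)(q²−4q+9)` solves
`P_VI(1/2,1/2,2/5,2/5;t)`. -/
theorem icosahedral_type45_solution
    (V : Set ℂ) (hVopen : IsOpen V)
    (u : ℂ → ℂ) (hudiff : ∀ q ∈ V, DifferentiableAt ℂ u q)
    (hu : ∀ q ∈ V, (u q)^2 = (q^2+1)*(q^2-4*q+9))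
    (t44 y45 : ℂ → ℂ)
    (ht44def : ∀ q ∈ V, t44 q = 1/2 +
      (q^10-10*q^9+45*q^8-120*q^7+190*q^6+4*q^5-410*q^4+680*q^3+25*q^2-90*q-27) /
        (2*(q^2-4*q-1)*(q^2+1)*(u q)^3))
    (hy45def : ∀ q ∈ V, y45 q = 1/2 +
      (3*q^10-24*q^9+93*q^8-216*q^7+446*q^6+320*q^5-1342*q^4+2824*q^3+527*q^2-312*q-207) /
        (6*(q^2-4*q-1)*(q^4-2*q^3+8*q^2+10*q+23)*(q^2+1)*(u q)))
    (hden : ∀ q ∈ V, 2*(q^2-4*q-1)*(q^2+1)*(u q)^3 ≠ 0 ∧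
      6*(q^2-4*q-1)*(q^4-2*q^3+8*q^2+10*q+23)*(q^2+1)*(u q) ≠ 0)
    (q₀ : ℂ) (hq₀ : q₀ ∈ V)
    (hder : deriv t44 q₀ ≠ 0)
    (ht0 : t44 q₀ ≠ 0) (ht1 : t44 q₀ ≠ 1)
    (hy0 : y45 q₀ ≠ 0) (hy1 : y45 q₀ ≠ 1) (hyt : y45 q₀ ≠ t44 q₀)
    (Y : ℂ → ℂ) (W : Set ℂ) (hWopen : IsOpen W) (hW : t44 q₀ ∈ W)
    (hYdiff : ∀ T ∈ W, DifferentiableAt ℂ Y T ∧ DifferentiableAt ℂ (deriv Y) T)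
    (V' : Set ℂ) (hV'open : IsOpen V') (hq₀V' : q₀ ∈ V') (hV'sub : V' ⊆ V)
    (hYeq : ∀ q ∈ V', Y (t44 q) = y45 q)
    (havoid : ∀ q ∈ V', t44 q ≠ 0 ∧ t44 q ≠ 1 ∧
      Y (t44 q) ≠ 0 ∧ Y (t44 q) ≠ 1 ∧ Y (t44 q) ≠ t44 q) :
    ∃ W' : Set ℂ, IsOpen W' ∧ t44 q₀ ∈ W' ∧
      IsPVISolutionOn (1/2) (1/2) (2/5) (2/5) Y W' := by
  have huV : ∀ q ∈ V, (u q)^2 = I45.pB q * I45.pC q := fun q hq => hu q hq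
  have hne : ∀ q ∈ V, I45.pA q ≠ 0 ∧ I45.pB q ≠ 0 ∧ I45.pC q ≠ 0 ∧ I45.pD q ≠ 0 ∧ u q ≠ 0 := by
    intro q hq
    obtain ⟨-, h2⟩ := hden q hq
    have h3 : 6 * I45.pA q * I45.pD q * I45.pB q * u q ≠ 0 := h2
    simp only [mul_ne_zero_iff] at h3
    obtain ⟨⟨⟨⟨-, hA⟩, hD⟩, hB⟩, hu0⟩ := h3
    refine ⟨hA, hB, ?_, hD, hu0⟩
    intro hC
    have := huV q hq
    rw [hC, mul_zero] at this
    exact hu0 (pow_eq_zero_iff (two_ne_zero) |>.1 this)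
  have htV : ∀ q ∈ V, t44 q = 1/2 + I45.pPn q / (2 * I45.pA q * I45.pB q^2 * I45.pC q * u q) := by
    intro q hq
    have e : t44 q = 1/2 + I45.pPn q / (2 * I45.pA q * I45.pB q * u q ^ 3) := ht44def q hq
    rw [e]
    congr 2
    linear_combination 2 * I45.pA q * I45.pB q * u q * huV q hq
  have hyV : ∀ q ∈ V, y45 q = 1/2 + I45.pR q / (6 * I45.pA q * I45.pD q * I45.pB q * u q) :=
    fun q hq => hy45def q hq
  have hdt : ∀ q ∈ V, HasDerivAt t44
      (-160*q^2*(2*q+1)^2*(q-2)^4*I45.pN q / (I45.pA q^2*I45.pB q^3*I45.pC q^2*u q)) q := by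
    intro q hq
    obtain ⟨hA, hB, hC, hD, hu0⟩ := hne q hq
    have hE : HasDerivAt (fun q => 2 * I45.pA q * I45.pB q^2 * I45.pC q)
        (2*(I45.dA q*I45.pB q^2*I45.pC q + 2*I45.pA q*I45.pB q*I45.dB q*I45.pC q
          + I45.pA q*I45.pB q^2*I45.dC q)) q := by
      refine ((((I45.hdA q).const_mul 2).fun_mul ((I45.hdB q).fun_pow 2)).fun_mul
        (I45.hdC q)).congr_deriv ?_
      push_cast
      ring
    have h := I45.core (f := t44) (I45.hdPn q) hE
      (I45.deriv_u hVopen hq (hudiff q hq) huV hu0) (huV q hq) (by simp [hA, hB, hC]) hu0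
      (Filter.eventually_of_mem (hVopen.mem_nhds hq) (fun x hx => htV x hx))
    refine h.congr_deriv ?_
    rw [I45.idt' q]
    field_simp
    ring
  have hdy : ∀ q ∈ V, HasDerivAt y45
      (-8*I45.pH q / (3*I45.pA q^2*I45.pD q^2*I45.pB q^2*I45.pC q*u q)) q := by
    intro q hq
    obtain ⟨hA, hB, hC, hD, hu0⟩ := hne q hq
    have hE : HasDerivAt (fun q => 6 * I45.pA q * I45.pD q * I45.pB q)
        (6*(I45.dA q*I45.pD q*I45.pB q + I45.pA q*I45.dD q*I45.pB q
          + I45.pA q*I45.pD q*I45.dB q)) q := by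
      refine ((((I45.hdA q).const_mul 6).fun_mul (I45.hdD q)).fun_mul
        (I45.hdB q)).congr_deriv ?_
      ring
    have h := I45.core (f := y45) (I45.hdR q) hE
      (I45.deriv_u hVopen hq (hudiff q hq) huV hu0) (huV q hq) (by simp [hA, hB, hD]) hu0
      (Filter.eventually_of_mem (hVopen.mem_nhds hq) (fun x hx => hyV x hx))
    refine h.congr_deriv ?_
    rw [I45.idy' q]
    field_simp
    ring
  have hT : ∀ q ∈ V, t44 q * (t44 q - 1) =
      16*q^3*(2*q+1)^3*(q-2)^5*I45.pN q^2/(I45.pA q^2*I45.pB q^5*I45.pC q^3) := by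
    intro q hq
    obtain ⟨hA, hB, hC, hD, hu0⟩ := hne q hq
    have e : t44 q * (t44 q - 1) =
        (I45.pPn q^2 - I45.pA q^2*I45.pB q^4*I45.pC q^2*u q^2)
          / (4*I45.pA q^2*I45.pB q^4*I45.pC q^2*u q^2) := by
      rw [htV q hq]; field_simp; ring
    have e2 := I45.idT q
    rw [e, huV q hq, show I45.pPn q^2 - I45.pA q^2*I45.pB q^4*I45.pC q^2*(I45.pB q*I45.pC q)
      = 64*q^3*(2*q+1)^3*(q-2)^5*(I45.pN q)^2 by linear_combination e2]
    field_simp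
    ring
  have hZ : ∀ q ∈ V, y45 q * (y45 q - 1) =
      4*q*(2*q+1)^2*I45.pS q/(9*I45.pA q^2*I45.pD q^2*I45.pB q^3*I45.pC q) := by
    intro q hq
    obtain ⟨hA, hB, hC, hD, hu0⟩ := hne q hq
    have e : y45 q * (y45 q - 1) =
        (I45.pR q^2 - 9*I45.pA q^2*I45.pD q^2*I45.pB q^2*u q^2)
          / (36*I45.pA q^2*I45.pD q^2*I45.pB q^2*u q^2) := by
      rw [hyV q hq]; field_simp; ring
    have e2 := I45.idZ q
    rw [e, huV q hq, show I45.pR q^2 - 9*I45.pA q^2*I45.pD q^2*I45.pB q^2*(I45.pB q*I45.pC q)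
      = 16*q*(2*q+1)^2*I45.pS q by linear_combination e2]
    field_simp
    ring
  have hE : ∀ q ∈ V, y45 q - t44 q =
      4*q*(2*q+1)^2*I45.pQ q/(3*I45.pA q*I45.pD q*I45.pB q^2*I45.pC q*u q) := by
    intro q hq
    obtain ⟨hA, hB, hC, hD, hu0⟩ := hne q hq
    have e : y45 q - t44 q = (I45.pR q*I45.pB q*I45.pC q - 3*I45.pD q*I45.pPn q)
          / (6*I45.pA q*I45.pD q*I45.pB q^2*I45.pC q*u q) := by
      rw [hyV q hq, htV q hq]; field_simp; ring
    rw [e, I45.idW q]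
    field_simp
    ring
  have hnz : ∀ q ∈ V', q ≠ 0 ∧ 2*q+1 ≠ 0 ∧ q-2 ≠ 0 ∧ I45.pN q ≠ 0 := by
    intro q hq
    obtain ⟨h0, h1, -⟩ := havoid q hq
    have h := mul_ne_zero h0 (sub_ne_zero.2 h1)
    rw [hT q (hV'sub hq)] at h
    refine ⟨?_, ?_, ?_, ?_⟩ <;> · intro hz; apply h; simp [hz]
  have hUopen : IsOpen (V' ∩ t44 ⁻¹' W) := by
    have hc : ContinuousOn t44 V' := fun q hq =>
      (hdt q (hV'sub hq)).continuousAt.continuousWithinAt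
    exact hc.isOpen_inter_preimage hV'open hWopen
  have hM : ∀ q ∈ V' ∩ t44 ⁻¹' W, deriv Y (t44 q) =
      I45.pK q / (60*I45.pD q^2*q^2*(2*q+1)*(q-2)^4*I45.pN q) := by
    rintro q ⟨hq, hqW⟩
    have hqV := hV'sub hq
    obtain ⟨hA, hB, hC, hD, hu0⟩ := hne q hqV
    obtain ⟨h0, hL, hG, hN⟩ := hnz q hq
    have h1 := (hYdiff _ hqW).1.hasDerivAt.comp q (hdt q hqV)
    have h2 : HasDerivAt (Y ∘ t44)
        (-8*I45.pH q / (3*I45.pA q^2*I45.pD q^2*I45.pB q^2*I45.pC q*u q)) q :=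
      (hdy q hqV).congr_of_eventuallyEq
        (Filter.eventually_of_mem (hV'open.mem_nhds hq) (fun x hx => hYeq x hx))
    have h3 := h1.unique h2
    have hτ : -160*q^2*(2*q+1)^2*(q-2)^4*I45.pN q
        / (I45.pA q^2*I45.pB q^3*I45.pC q^2*u q) ≠ 0 := by
      simp [h0, hL, hG, hN, hA, hB, hC, hu0]
    rw [← eq_div_iff hτ] at h3
    have e : I45.pK q = I45.pH q*I45.pB q*I45.pC q / (2*q+1) := by
      rw [I45.idM q]; field_simp
    rw [h3, e]
    field_simp
    ring
  have hMd : ∀ q ∈ V' ∩ t44 ⁻¹' W, (y45 q - t44 q) * deriv (deriv Y) (t44 q) =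
      -(I45.pQ q*I45.pK2 q*I45.pA q*I45.pB q*I45.pC q)
        /(7200*I45.pD q^4*q^4*(2*q+1)^2*(q-2)^9*I45.pN q^3) := by
    rintro q ⟨hq, hqW⟩
    have hqV := hV'sub hq
    obtain ⟨hA, hB, hC, hD, hu0⟩ := hne q hqV
    obtain ⟨h0, hL, hG, hN⟩ := hnz q hq
    have h1 := (hYdiff _ hqW).2.hasDerivAt.comp q (hdt q hqV)
    have h2 := (I45.deriv_M h0 hL hG hN hD).congr_of_eventuallyEq (f₁ := deriv Y ∘ t44)
        (Filter.eventually_of_mem (hUopen.mem_nhds ⟨hq, hqW⟩) (fun x hx => hM x hx))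
    have h3 := h1.unique h2
    have hτ : -160*q^2*(2*q+1)^2*(q-2)^4*I45.pN q
        / (I45.pA q^2*I45.pB q^3*I45.pC q^2*u q) ≠ 0 := by
      simp [h0, hL, hG, hN, hA, hB, hC, hu0]
    rw [← eq_div_iff hτ] at h3
    rw [h3, hE q hqV]
    field_simp
    ring
  have hWo : IsOpen (t44 '' (V' ∩ t44 ⁻¹' W)) := by
    rw [isOpen_iff_mem_nhds]
    rintro _ ⟨q, hq, rfl⟩
    have hqV := hV'sub hq.1
    obtain ⟨hA, hB, hC, hD, hu0⟩ := hne q hqV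
    obtain ⟨h0, hL, hG, hN⟩ := hnz q hq.1
    have hdiff : DifferentiableOn ℂ t44 V := fun x hx =>
      (hdt x hx).differentiableAt.differentiableWithinAt
    have hs := (hdiff.analyticAt (hVopen.mem_nhds hqV)).hasStrictDerivAt
    have hτ : deriv t44 q ≠ 0 := by
      rw [(hdt q hqV).deriv]
      simp [h0, hL, hG, hN, hA, hB, hC, hu0]
    rw [← hs.map_nhds_eq hτ]
    exact Filter.image_mem_map (hUopen.mem_nhds hq)
  refine ⟨t44 '' (V' ∩ t44 ⁻¹' W), hWo, ⟨q₀, ⟨hq₀V', hW⟩, rfl⟩, hWo, ?_, ?_, ?_⟩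
  · rintro _ ⟨q, hq, rfl⟩
    exact havoid q hq.1
  · rintro _ ⟨q, hq, rfl⟩
    exact hYdiff _ hq.2
  · rintro _ ⟨q, hq, rfl⟩
    have hqV := hV'sub hq.1
    obtain ⟨hA, hB, hC, hD, hu0⟩ := hne q hqV
    obtain ⟨h0, hL, hG, hN⟩ := hnz q hq.1
    obtain ⟨a0, a1, b0, b1, b2⟩ := havoid q hq.1
    rw [hYeq q hq.1] at b0 b1 b2
    have hWW : (y45 q - t44 q)^2 = 16*q^2*(2*q+1)^4*I45.pQ q^2
        /(9*I45.pA q^2*I45.pD q^2*I45.pB q^5*I45.pC q^3) := by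
      rw [hE q hqV, div_pow, mul_pow _ (u q) 2, huV q hqV]
      field_simp
      ring
    exact I45.pvi_of_poly Y (t44 q) (y45 q) _ _ (hYeq q hq.1) rfl rfl a0 (sub_ne_zero.2 a1) b0
      (sub_ne_zero.2 b1) (sub_ne_zero.2 b2) _ _ _ rfl rfl rfl
      (I45.abstract_id q (2*q+1) (q-2) (I45.pN q) (I45.pA q) (I45.pB q) (I45.pC q) (I45.pD q)
        (I45.pS q) (I45.pQ q) (I45.pK q) (I45.pK2 q) _ _ _ _ _ h0 hL hG hN hA hB hC hD
        (hT q hqV) (hZ q hqV) hWW (hM q hq) (hMd q hq) (I45.big q))
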